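/- arXiv:2310.02403 — 2 statements merged into one kernel-verified Lean document; each statement's English description precedes it below -/
import Mathlib

section
/- The 4-strand Burau representation reduced modulo 5 is not faithful: the group homomorphism from the 4-strand braid group B4 (presented as <s1,s2,s3 | s1s2s1=s2s1s2, s2s3s2=s3s2s3, s1s3=s3s1>) to GL_3((Z/5Z)[v,v^{-1}]) sending s_i to the Burau matrix B_i is not injective. -/
open LaurentPolynomial FreeGroup

/-- The three reduced Burau matrices `B1, B2, B3` for the 4-strand braid group,
over the Laurent polynomial ring `R[v,v⁻¹]` (here `v = T 1`). -/
noncomputable def BurauB (R : Type) [CommRing R] : Fin 3 → Matrix (Fin 3) (Fin 3) (LaurentPolynomial R)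
  | 0 => !![-(T 1)^2, -(T 1), 0; 0, 1, 0; 0, 0, 1]
  | 1 => !![1, 0, 0; -(T 1), -(T 1)^2, -(T 1); 0, 0, 1]
  | 2 => !![1, 0, 0; 0, 1, 0; 0, -(T 1), -(T 1)^2]

/-- The braid relations of the 4-strand braid group, as elements of the free group
on generators `s1 = of 0`, `s2 = of 1`, `s3 = of 2`. -/
def braidRels4 : Set (FreeGroup (Fin 3)) :=
  { of 0 * of 1 * of 0 * (of 1 * of 0 * of 1)⁻¹,
    of 1 * of 2 * of 1 * (of 2 * of 1 * of 2)⁻¹,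
    of 0 * of 2 * (of 2 * of 0)⁻¹ }

/-- The 4-strand braid group, presented by the Artin generators and braid relations. -/
def B4 : Type := PresentedGroup braidRels4

noncomputable instance : Group B4 := by unfold B4; infer_instance

namespace BurauFive

/-- Burau matrices over any ring with parameter `t`. -/
def bm {R : Type} [CommRing R] (t : R) : Fin 3 → Matrix (Fin 3) (Fin 3) R
  | 0 => !![-t^2, -t, 0; 0, 1, 0; 0, 0, 1]
  | 1 => !![1, 0, 0; -t, -t^2, -t; 0, 0, 1]
  | 2 => !![1, 0, 0; 0, 1, 0; 0, -t, -t^2]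

theorem bm_mul_inv {R : Type} [CommRing R] (t s : R) (h : t * s = 1) (i : Fin 3) :
    bm t i * (match i with
      | 0 => !![-s^2, -s, 0; 0, 1, 0; 0, 0, 1]
      | 1 => !![1, 0, 0; -s, -s^2, -s; 0, 0, 1]
      | 2 => !![1, 0, 0; 0, 1, 0; 0, -s, -s^2]) = 1 := by
  have h2 : t ^ 2 * s ^ 2 = 1 := by rw [← mul_pow, h, one_pow]
  have h3 : t ^ 2 * s = t := by rw [pow_two, mul_assoc, h, mul_one]
  fin_cases i <;> ext a b <;> fin_cases a <;> fin_cases b <;>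
    simp [bm, Matrix.mul_apply, Fin.sum_univ_three, h2, h3]

noncomputable def bu {R : Type} [CommRing R] (t s : R) (h : t * s = 1) (i : Fin 3) :
    GL (Fin 3) R :=
  ⟨bm t i, _, bm_mul_inv t s h i, mul_eq_one_comm.mp (bm_mul_inv t s h i)⟩

theorem bu_val {R : Type} [CommRing R] (t s : R) (h : t * s = 1) (i : Fin 3) :
    ((bu t s h i : GL (Fin 3) R) : Matrix (Fin 3) (Fin 3) R) = bm t i := rfl

theorem rel1 {R : Type} [CommRing R] (t : R) :
    bm t 0 * bm t 1 * bm t 0 = bm t 1 * bm t 0 * bm t 1 := by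
  ext a b; fin_cases a <;> fin_cases b <;>
    simp [bm, Matrix.mul_apply, Fin.sum_univ_three] <;> ring
theorem rel2 {R : Type} [CommRing R] (t : R) :
    bm t 1 * bm t 2 * bm t 1 = bm t 2 * bm t 1 * bm t 2 := by
  ext a b; fin_cases a <;> fin_cases b <;>
    simp [bm, Matrix.mul_apply, Fin.sum_univ_three] <;> ring
theorem rel3 {R : Type} [CommRing R] (t : R) :
    bm t 0 * bm t 2 = bm t 2 * bm t 0 := by
  ext a b; fin_cases a <;> fin_cases b <;>
    simp [bm, Matrix.mul_apply, Fin.sum_univ_three]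

theorem exists_hom {R : Type} [CommRing R] (t s : R) (h : t * s = 1) :
    ∃ π : B4 →* GL (Fin 3) R, ∀ i : Fin 3,
      (π (PresentedGroup.of i) : Matrix (Fin 3) (Fin 3) R) = bm t i := by
  have hr : ∀ r ∈ braidRels4, FreeGroup.lift (bu t s h) r = 1 := by
    intro r hr
    simp only [braidRels4, Set.mem_insert_iff, Set.mem_singleton_iff] at hr
    rcases hr with rfl | rfl | rfl <;>
      simp only [_root_.map_mul, _root_.map_inv, FreeGroup.lift_apply_of, mul_inv_eq_one] <;>
      apply Units.ext <;> simp only [Units.val_mul, bu_val]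
    · exact rel1 t
    · exact rel2 t
    · exact rel3 t
  refine ⟨PresentedGroup.toGroup hr, fun i => ?_⟩
  have := PresentedGroup.toGroup.of hr (x := i)
  exact (congrArg Units.val this).trans (bu_val t s h i)

/-- Row vector action of a positive word. -/
def actR {R : Type} [CommRing R] (t : R) : List (Fin 3) → R → R → R → R × R × R
  | [], a, b, c => (a, b, c)
  | 0 :: w, a, b, c => actR t w (0 - t * (t * a)) (b - t * a) c
  | 1 :: w, a, b, c => actR t w (a - t * b) (0 - t * (t * b)) (c - t * b)
  | 2 :: w, a, b, c => actR t w a (b - t * c) (0 - t * (t * c))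

theorem actR_spec {R : Type} [CommRing R] (t : R) (w : List (Fin 3)) (a b c : R) :
    Matrix.vecMul ![a, b, c] (w.map (bm t)).prod =
      ![(actR t w a b c).1, (actR t w a b c).2.1, (actR t w a b c).2.2] := by
  induction w generalizing a b c with
  | nil => simp [actR]
  | cons g w ih =>
    rw [List.map_cons, List.prod_cons, ← Matrix.vecMul_vecMul]
    fin_cases g
    · have : Matrix.vecMul ![a, b, c] (bm t 0) = ![0 - t * (t * a), b - t * a, c] := by
        ext j; fin_cases j <;> simp [bm, Matrix.vecMul, dotProduct, Fin.sum_univ_three] <;> ring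
      exact (congrArg (fun v => Matrix.vecMul v _) this).trans (ih _ _ _)
    · have : Matrix.vecMul ![a, b, c] (bm t 1) = ![a - t * b, 0 - t * (t * b), c - t * b] := by
        ext j; fin_cases j <;> simp [bm, Matrix.vecMul, dotProduct, Fin.sum_univ_three] <;> ring
      exact (congrArg (fun v => Matrix.vecMul v _) this).trans (ih _ _ _)
    · have : Matrix.vecMul ![a, b, c] (bm t 2) = ![a, b - t * c, 0 - t * (t * c)] := by
        ext j; fin_cases j <;> simp [bm, Matrix.vecMul, dotProduct, Fin.sum_univ_three] <;> ring
      exact (congrArg (fun v => Matrix.vecMul v _) this).trans (ih _ _ _)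

/-- Subtraction of polynomials mod 5, given as coefficient lists. -/
def ax : List ℕ → List ℕ → List ℕ
  | [], l => l.map (fun a => (4 * a) % 5)
  | b :: bs, [] => b :: bs
  | b :: bs, a :: as => ((b + 4 * a) % 5) :: ax bs as

def ev {R : Type} [CommRing R] (t : R) : List ℕ → R
  | [] => 0
  | c :: l => (c : R) + t * ev t l

theorem cast_mod5 {R : Type} [CommRing R] (h5 : (5 : R) = 0) (n : ℕ) :
    ((n % 5 : ℕ) : R) = n := by
  conv_rhs => rw [← Nat.mod_add_div n 5]
  push_cast
  rw [h5]; ring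

theorem four_eq {R : Type} [CommRing R] (h5 : (5 : R) = 0) : (4 : R) = -1 := by
  linear_combination h5

theorem ev_ax {R : Type} [CommRing R] (h5 : (5 : R) = 0) (t : R) (l m : List ℕ) :
    ev t (ax l m) = ev t l - ev t m := by
  induction l generalizing m with
  | nil =>
    simp only [ax]
    induction m with
    | nil => simp [ev]
    | cons a m ih =>
      simp only [List.map_cons, ev] at ih ⊢
      rw [ih, cast_mod5 h5]; push_cast; rw [four_eq h5]; ring
  | cons b bs ih =>
    cases m with
    | nil => simp [ax, ev]
    | cons a m =>
      simp only [ax, ev]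
      rw [ih, cast_mod5 h5]; push_cast; rw [four_eq h5]; ring

def actL : List (Fin 3) → List ℕ → List ℕ → List ℕ → List ℕ × List ℕ × List ℕ
  | [], a, b, c => (a, b, c)
  | 0 :: w, a, b, c => actL w (ax [] (0 :: 0 :: a)) (ax b (0 :: a)) c
  | 1 :: w, a, b, c => actL w (ax a (0 :: b)) (ax [] (0 :: 0 :: b)) (ax c (0 :: b))
  | 2 :: w, a, b, c => actL w a (ax b (0 :: c)) (ax [] (0 :: 0 :: c))

theorem actL_spec {R : Type} [CommRing R] (h5 : (5 : R) = 0) (t : R) (w : List (Fin 3))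
    (a b c : List ℕ) :
    actR t w (ev t a) (ev t b) (ev t c) =
      (ev t (actL w a b c).1, ev t (actL w a b c).2.1, ev t (actL w a b c).2.2) := by
  have e1 : ∀ l : List ℕ, ev t (0 :: l) = t * ev t l := fun l => by simp [ev]
  have e0 : ev t ([] : List ℕ) = 0 := rfl
  induction w generalizing a b c with
  | nil => rfl
  | cons g w ih =>
    fin_cases g
    · have := ih (ax [] (0 :: 0 :: a)) (ax b (0 :: a)) c
      simp only [ev_ax h5, e1, e0] at this
      exact this
    · have := ih (ax a (0 :: b)) (ax [] (0 :: 0 :: b)) (ax c (0 :: b))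
      simp only [ev_ax h5, e1, e0] at this
      exact this
    · have := ih a (ax b (0 :: c)) (ax [] (0 :: 0 :: c))
      simp only [ev_ax h5, e1, e0] at this
      exact this

def isZ (l : List ℕ) : Bool := l.all (fun n => Nat.beq n 0)

theorem ev_isZ {R : Type} [CommRing R] (t : R) (l : List ℕ) (h : isZ l = true) : ev t l = 0 := by
  induction l with
  | nil => rfl
  | cons a l ih =>
    simp only [isZ, List.all_cons, Bool.and_eq_true] at h
    have ha : a = 0 := Nat.eq_of_beq_eq_true h.1
    simp [ev, ha, ih h.2]

def eqL (p q : List ℕ × List ℕ × List ℕ) : Bool :=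
  isZ (ax p.1 q.1) && (isZ (ax p.2.1 q.2.1) && isZ (ax p.2.2 q.2.2))

/-- The key braid of length 36. -/
def wX : List (Fin 3) :=
  [0, 2, 1, 1, 0, 2, 0, 1, 1, 0, 2, 0, 1, 1, 1, 0, 2, 0, 1, 2, 1, 1, 0, 2, 0, 1, 2, 1, 1, 0, 2,
    0, 1, 2, 1, 0]

def wP : List (Fin 3) := wX ++ wX ++ wX ++ wX ++ wX

/-- The sixth power of the half twist. -/
def wQ6 : List (Fin 3) := [0, 1, 0, 2, 1, 0] ++ [0, 1, 0, 2, 1, 0] ++ [0, 1, 0, 2, 1, 0] ++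
  [0, 1, 0, 2, 1, 0] ++ [0, 1, 0, 2, 1, 0] ++ [0, 1, 0, 2, 1, 0]
def wQ : List (Fin 3) := wQ6 ++ wQ6 ++ wQ6 ++ wQ6 ++ wQ6

def m00 : List ℕ := [0, 0, 0, 0, 0, 0, 0, 0, 0, 0, 0, 0, 0, 0, 3, 0, 1, 0, 3, 0, 1, 0, 1, 0, 1, 0, 4, 0, 4, 0, 0, 0, 1, 0, 4, 0, 3]
def m01 : List ℕ := [0, 0, 0, 0, 0, 0, 0, 0, 0, 0, 0, 0, 0, 3, 0, 1, 0, 0, 0, 0, 0, 2, 0, 2, 0, 0, 0, 0, 0, 0, 0, 0, 0, 2]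
def m02 : List ℕ := [0, 0, 0, 0, 0, 0, 0, 0, 0, 0, 0, 0, 0, 0, 3, 0, 3, 0, 1, 0, 4, 0, 1, 0, 4, 0, 2, 0, 1, 0, 0, 0, 1, 0, 3, 0, 2]
def m10 : List ℕ := [0, 0, 0, 0, 0, 0, 0, 0, 0, 0, 0, 0, 0, 0, 0, 0, 0, 0, 0, 0, 0, 0, 0, 1, 0, 3, 0, 4, 0, 3, 0, 3, 0, 4, 0, 2]
def m11 : List ℕ := [0, 0, 0, 0, 0, 0, 0, 0, 0, 0, 0, 0, 0, 0, 0, 0, 0, 0, 0, 0, 0, 0, 0, 0, 3, 0, 3, 0, 0, 0, 2, 0, 3]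
def m12 : List ℕ := [0, 0, 0, 0, 0, 0, 0, 0, 0, 0, 0, 0, 0, 0, 0, 0, 0, 0, 0, 0, 0, 0, 0, 1, 0, 2, 0, 4, 0, 4, 0, 2, 0, 4, 0, 3]
def m20 : List ℕ := [0, 0, 0, 0, 0, 0, 0, 0, 0, 0, 0, 0, 0, 0, 2, 0, 1, 0, 2, 0, 1, 0, 4, 0, 2, 0, 3, 0, 4, 0, 3, 0, 4, 0, 1, 0, 3]
def m21 : List ℕ := [0, 0, 0, 0, 0, 0, 0, 0, 0, 0, 0, 0, 0, 2, 0, 1, 0, 0, 0, 0, 0, 3, 0, 1, 0, 3, 0, 2, 0, 3, 0, 3, 0, 2]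
def m22 : List ℕ := [0, 0, 0, 0, 0, 0, 0, 0, 0, 0, 0, 0, 0, 0, 2, 0, 4, 0, 2, 0, 4, 0, 4, 0, 4, 0, 3, 0, 1, 0, 3, 0, 1, 0, 1, 0, 2]

theorem keyX0 : eqL (actL wX [1] [] []) (m00, m01, m02) = true := by decide +kernel
theorem keyX1 : eqL (actL wX [] [1] []) (m10, m11, m12) = true := by decide +kernel
theorem keyX2 : eqL (actL wX [] [] [1]) (m20, m21, m22) = true := by decide +kernel

/-- Polynomial multiplication. -/
def ml : List ℕ → List ℕ → List ℕ
  | [], _ => []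
  | a :: l, m => ax (m.map (fun x => a * x)) (ax [] (0 :: ml l m))

theorem ev_smul {R : Type} [CommRing R] (t : R) (a : ℕ) (m : List ℕ) :
    ev t (m.map (fun x => a * x)) = a * ev t m := by
  induction m with
  | nil => simp [ev]
  | cons b m ih => simp only [List.map_cons, ev, ih]; push_cast; ring

theorem ev_ml {R : Type} [CommRing R] (h5 : (5 : R) = 0) (t : R) (l m : List ℕ) :
    ev t (ml l m) = ev t l * ev t m := by
  induction l with
  | nil => simp [ml, ev]
  | cons a l ih =>
    simp only [ml, ev_ax h5, ev_smul, ev, ih]; push_cast; ring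

def mono (n : ℕ) : List ℕ := (List.replicate n 0) ++ [3]

theorem ev_mono {R : Type} [CommRing R] (t : R) (n : ℕ) : ev t (mono n) = 3 * t ^ n := by
  induction n with
  | zero => simp [mono, ev]
  | succ n ih =>
    have : mono (n + 1) = 0 :: mono n := by simp [mono, List.replicate_succ]
    rw [this, ev, ih]; push_cast; ring

theorem keyTr : isZ (ax (ax (ax (mono 24) m00) m11) m22) = true := by decide +kernel
theorem keyE2 : isZ (ax (ax (ax (ax (mono 48) (ax (ml m00 m11) (ml m01 m10)))
    (ax (ml m00 m22) (ml m02 m20))) (ax (ml m11 m22) (ml m12 m21))) []) = true := by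
  decide +kernel

theorem row_of_key {R : Type} [CommRing R] (h5 : (5 : R) = 0) (t : R) (a b c x y z : List ℕ)
    (w : List (Fin 3)) (h : eqL (actL w a b c) (x, y, z) = true) :
    Matrix.vecMul ![ev t a, ev t b, ev t c] (w.map (bm t)).prod = ![ev t x, ev t y, ev t z] := by
  rw [actR_spec, actL_spec h5]
  simp only [eqL, Bool.and_eq_true] at h
  obtain ⟨h1, h2, h3⟩ := h
  have h1 := ev_isZ t _ h1
  have h2 := ev_isZ t _ h2
  have h3 := ev_isZ t _ h3
  rw [ev_ax h5, sub_eq_zero] at h1 h2 h3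
  rw [h1, h2, h3]

theorem mat_of_keys {R : Type} [CommRing R] (h5 : (5 : R) = 0) (t : R) (w : List (Fin 3))
    (a b c d e f g h i : List ℕ)
    (h0 : eqL (actL w [1] [] []) (a, b, c) = true)
    (h1 : eqL (actL w [] [1] []) (d, e, f) = true)
    (h2 : eqL (actL w [] [] [1]) (g, h, i) = true) :
    (w.map (bm t)).prod =
      !![ev t a, ev t b, ev t c; ev t d, ev t e, ev t f; ev t g, ev t h, ev t i] := by
  have e0 : ev t ([] : List ℕ) = 0 := rfl
  have e1 : ev t [1] = 1 := by simp [ev]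
  have k0 := row_of_key h5 t _ _ _ _ _ _ _ h0
  have k1 := row_of_key h5 t _ _ _ _ _ _ _ h1
  have k2 := row_of_key h5 t _ _ _ _ _ _ _ h2
  rw [e0, e1] at k0 k1 k2
  generalize (w.map (bm t)).prod = A at *
  ext i j
  fin_cases i
  · simpa [Matrix.vecMul, dotProduct, Fin.sum_univ_three] using congrFun k0 j
  · simpa [Matrix.vecMul, dotProduct, Fin.sum_univ_three] using congrFun k1 j
  · simpa [Matrix.vecMul, dotProduct, Fin.sum_univ_three] using congrFun k2 j

theorem det_bm {R : Type} [CommRing R] (t : R) (i : Fin 3) : (bm t i).det = -t ^ 2 := by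
  fin_cases i <;> simp [bm, Matrix.det_fin_three]

theorem det_word {R : Type} [CommRing R] (t : R) (w : List (Fin 3)) :
    ((w.map (bm t)).prod).det = (-t ^ 2) ^ w.length := by
  induction w with
  | nil => simp
  | cons g w ih => rw [List.map_cons, List.prod_cons, Matrix.det_mul, ih, det_bm,
      List.length_cons, pow_succ' (-t ^ 2)]

theorem nilp {R : Type} [CommRing R] (s a b c d e f g h i : R)
    (ht : a + e + i = 3 * s)
    (he : (a * e - b * d) + (a * i - c * g) + (e * i - f * h) = 3 * s ^ 2)
    (hd : (!![a, b, c; d, e, f; g, h, i] : Matrix (Fin 3) (Fin 3) R).det = s ^ 3) :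
    (!![a, b, c; d, e, f; g, h, i] - Matrix.scalar (Fin 3) s) ^ 3 = 0 := by
  rw [Matrix.det_fin_three] at hd
  simp at hd
  have hi : i = 3 * s - a - e := by linear_combination ht
  subst hi
  rw [pow_succ, pow_two]
  ext x y
  fin_cases x <;> fin_cases y <;>
    simp [Matrix.mul_apply, Fin.sum_univ_three]
  · linear_combination hd - a * he
  · linear_combination - b * he
  · linear_combination - c * he
  · linear_combination - d * he
  · linear_combination hd - e * he
  · linear_combination - f * he
  · linear_combination - g * he
  · linear_combination - h * he
  · linear_combination hd - (3 * s - a - e) * he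

theorem pow5 {R : Type} [CommRing R] [CharP R 5] (s : R) (A : Matrix (Fin 3) (Fin 3) R)
    (h : (A - Matrix.scalar (Fin 3) s) ^ 3 = 0) : A ^ 5 = Matrix.scalar (Fin 3) (s ^ 5) := by
  haveI : Fact (Nat.Prime 5) := ⟨by norm_num⟩
  have hc : Commute A (Matrix.scalar (Fin 3) s) :=
    (Matrix.scalar_commute s (fun r => mul_comm _ _) A).symm
  have h1 := sub_pow_char_of_commute (p := 5) hc
  have h2 : (A - Matrix.scalar (Fin 3) s) ^ 5 = 0 := by
    rw [show 5 = 3 + 2 from rfl, pow_add, h, zero_mul]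
  rw [h2] at h1
  rw [_root_.map_pow]
  exact (sub_eq_zero.mp h1.symm)

theorem prodX {R : Type} [CommRing R] [CharP R 5] (h5 : (5 : R) = 0) (t : R) :
    ((wX.map (bm t)).prod) ^ 5 = Matrix.scalar (Fin 3) ((t ^ 24) ^ 5) := by
  apply pow5
  have hd := det_word t wX
  have hM := mat_of_keys h5 t wX _ _ _ _ _ _ _ _ _ keyX0 keyX1 keyX2
  rw [hM] at hd ⊢
  have h1 := ev_isZ t _ keyTr
  have h2 := ev_isZ t _ keyE2
  have e0 : ev t ([] : List ℕ) = 0 := rfl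
  simp only [ev_ax h5, ev_ml h5, ev_mono, e0] at h1 h2
  apply nilp
  · linear_combination -h1
  · linear_combination -h2
  · rw [hd, show wX.length = 36 from rfl]; ring

theorem prodD {R : Type} [CommRing R] (t : R) :
    (([0, 1, 0, 2, 1, 0, 0, 1, 0, 2, 1, 0] : List (Fin 3)).map (bm t)).prod =
      Matrix.scalar (Fin 3) (t ^ 8) := by
  have hv := actR_spec t [0, 1, 0, 2, 1, 0, 0, 1, 0, 2, 1, 0]
  have h0 := hv 1 0 0
  have h1 := hv 0 1 0
  have h2 := hv 0 0 1
  generalize (List.map (bm t) _).prod = A at *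
  simp only [actR] at h0 h1 h2
  ext i j
  fin_cases i
  · have := congrFun h0 j
    fin_cases j <;> simp [Matrix.vecMul, dotProduct, Fin.sum_univ_three] at this ⊢ <;>
      rw [this] <;> ring
  · have := congrFun h1 j
    fin_cases j <;> simp [Matrix.vecMul, dotProduct, Fin.sum_univ_three] at this ⊢ <;>
      rw [this] <;> ring
  · have := congrFun h2 j
    fin_cases j <;> simp [Matrix.vecMul, dotProduct, Fin.sum_univ_three] at this ⊢ <;>
      rw [this] <;> ring

theorem prod_eq {R : Type} [CommRing R] [CharP R 5] (h5 : (5 : R) = 0) (t : R) :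
    (wP.map (bm t)).prod = (wQ.map (bm t)).prod := by
  have hP : (wP.map (bm t)).prod = ((wX.map (bm t)).prod) ^ 5 := by
    simp only [wP, List.map_append, List.prod_append, pow_succ, pow_zero, one_mul]
  have hD := prodD t
  have hQ : wQ6 = [0, 1, 0, 2, 1, 0, 0, 1, 0, 2, 1, 0] ++ [0, 1, 0, 2, 1, 0, 0, 1, 0, 2, 1, 0] ++
    [0, 1, 0, 2, 1, 0, 0, 1, 0, 2, 1, 0] := rfl
  have hQ6 : (wQ6.map (bm t)).prod = Matrix.scalar (Fin 3) (t ^ 24) := by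
    rw [hQ, List.map_append, List.map_append, List.prod_append, List.prod_append, hD,
      ← _root_.map_mul, ← _root_.map_mul]
    congr 1; ring
  rw [hP, prodX h5, wQ]
  simp only [List.map_append, List.prod_append, hQ6, ← _root_.map_mul]
  congr 1; ring

/-- The Artin generators. -/
noncomputable def gen (i : Fin 3) : B4 := PresentedGroup.of i

/-- The braid given by a positive word. -/
noncomputable def br (w : List (Fin 3)) : B4 :=
  (w.map gen).prod

theorem hom_br {R : Type} [CommRing R] (t : R) (π : B4 →* GL (Fin 3) R)
    (h : ∀ i : Fin 3, (π (PresentedGroup.of i) : Matrix (Fin 3) (Fin 3) R) = bm t i)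
    (w : List (Fin 3)) :
    (π (br w) : Matrix (Fin 3) (Fin 3) R) = (w.map (bm t)).prod := by
  induction w with
  | nil => simp [br]
  | cons g w ih =>
    have : br (g :: w) = gen g * br w := by simp [br]
    have hg : (π (gen g) : Matrix (Fin 3) (Fin 3) R) = bm t g := h g
    rw [this, _root_.map_mul, Units.val_mul, ih, hg, List.map_cons, List.prod_cons]

theorem key7 : actR (2 : ZMod 7) wP 1 0 0 ≠ actR (2 : ZMod 7) wQ 1 0 0 := by decide +kernel

theorem br_ne : br wP ≠ br wQ := by
  intro he
  obtain ⟨π, hπ⟩ := exists_hom (2 : ZMod 7) 4 (by decide)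
  have h := hom_br _ π hπ wP
  rw [he, hom_br _ π hπ wQ] at h
  have h' := congrArg (Matrix.vecMul ![1, 0, 0]) h
  rw [actR_spec, actR_spec] at h'
  apply key7
  have a0 := congrFun h' 0
  have a1 := congrFun h' 1
  have a2 := congrFun h' 2
  exact (Prod.ext a0 (Prod.ext a1 a2)).symm

theorem burauB_eq (R : Type) [CommRing R] (i : Fin 3) :
    BurauB R i = bm (LaurentPolynomial.T 1 : LaurentPolynomial R) i := by
  fin_cases i <;> rfl

theorem five_zero : (5 : LaurentPolynomial (ZMod 5)) = 0 := by
  have h : (5 : ZMod 5) = 0 := by decide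
  have := congrArg (LaurentPolynomial.C (R := ZMod 5)) h
  rw [map_ofNat, map_zero] at this
  exact this

end BurauFive

/-- The 4-strand Burau representation reduced modulo 5 is not faithful. -/
theorem burau_mod_five_not_faithful :
    (∃ π : B4 →* GL (Fin 3) (LaurentPolynomial (ZMod 5)),
      ∀ i : Fin 3, (π (PresentedGroup.of i) : Matrix (Fin 3) (Fin 3) (LaurentPolynomial (ZMod 5))) = BurauB (ZMod 5) i) ∧
    (∀ π : B4 →* GL (Fin 3) (LaurentPolynomial (ZMod 5)),
      (∀ i : Fin 3, (π (PresentedGroup.of i) : Matrix (Fin 3) (Fin 3) (LaurentPolynomial (ZMod 5))) = BurauB (ZMod 5) i) →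
      ¬ Function.Injective π) := by
  refine ⟨?_, ?_⟩
  · obtain ⟨π, h⟩ := BurauFive.exists_hom (T 1 : LaurentPolynomial (ZMod 5)) (T (-1))
      (by rw [← T_add]; simp)
    exact ⟨π, fun i => (h i).trans (BurauFive.burauB_eq _ i).symm⟩
  · intro π h hinj
    apply BurauFive.br_ne
    apply hinj
    apply Units.ext
    have h' := fun i => (h i).trans (BurauFive.burauB_eq _ i)
    rw [BurauFive.hom_br _ π h', BurauFive.hom_br _ π h']
    haveI : CharP (LaurentPolynomial (ZMod 5)) 5 :=
      charP_of_injective_ringHom (f := LaurentPolynomial.C (R := ZMod 5)) (by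
        haveI : Fact (Nat.Prime 5) := ⟨by norm_num⟩
        exact RingHom.injective _) 5
    exact BurauFive.prod_eq BurauFive.five_zero _
end

section
/- The 3-strand Burau representation is faithful: the group homomorphism from the 3-strand braid group B3 (presented as <s1,s2 | s1s2s1 = s2s1s2>) to GL_2(Z[v,v^{-1}]) sending s1 to A1 and s2 to A2 is injective. -/
open LaurentPolynomial FreeGroup

/-- The two reduced Burau matrices `A1, A2` for the 3-strand braid group,
over the Laurent polynomial ring `ℤ[v,v⁻¹]` (here `v = T 1`). -/
noncomputable def BurauA : Fin 2 → Matrix (Fin 2) (Fin 2) (LaurentPolynomial ℤ)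
  | 0 => !![-(T 1)^2, -(T 1); 0, 1]
  | 1 => !![1, 0; -(T 1), -(T 1)^2]

/-- The braid relation of the 3-strand braid group, as an element of the free group
on generators `s1 = of 0`, `s2 = of 1`. -/
def braidRels3 : Set (FreeGroup (Fin 2)) :=
  { of 0 * of 1 * of 0 * (of 1 * of 0 * of 1)⁻¹ }

/-- The 3-strand braid group, presented by the Artin generators and the braid relation. -/
def B3 : Type := PresentedGroup braidRels3

noncomputable instance : Group B3 := by unfold B3; infer_instance

inductive BMon {G : Type} [Group G] (s t : G) : G → Prop
  | one : BMon s t 1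
  | left (m : G) : BMon s t m → BMon s t (s * m)
  | right (m : G) : BMon s t m → BMon s t (t⁻¹ * m)

def BForm {G : Type} [Group G] (s t g : G) : Prop :=
  ∃ (k : ℤ) (p m q : G), (p = 1 ∨ p = s * t * s) ∧ BMon s t m ∧
    (q = 1 ∨ q = s * t ∨ q = s * t * (s * t)) ∧
    g = ((s * t * s) * (s * t * s)) ^ k * (p * m * q)

section
variable {G : Type} [Group G] {s t : G}

theorem b_as (h : s * t * s = t * s * t) : (s * t * s) * s = t * (s * t * s) := by
  rw [show t * (s * t * s) = (t * s * t) * s by group, ← h]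

theorem b_at (h : s * t * s = t * s * t) : (s * t * s) * t = s * (s * t * s) := by
  nth_rw 2 [h]; group

theorem b_zs (h : s * t * s = t * s * t) : Commute ((s * t * s) * (s * t * s)) s := by
  unfold Commute SemiconjBy
  rw [mul_assoc, b_as h, ← mul_assoc, b_at h, mul_assoc]

theorem b_zt (h : s * t * s = t * s * t) : Commute ((s * t * s) * (s * t * s)) t := by
  unfold Commute SemiconjBy
  rw [mul_assoc, b_at h, ← mul_assoc, b_as h, mul_assoc]

theorem b_bbb (h : s * t * s = t * s * t) :
    (s * t) * (s * t * (s * t)) = (s * t * s) * (s * t * s) := by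
  rw [show (s * t) * (s * t * (s * t)) = (s * t * s) * (t * s * t) by group, ← h]

theorem form_z (j : ℤ) {g : G} (hg : BForm s t g) :
    BForm s t (((s * t * s) * (s * t * s)) ^ j * g) := by
  obtain ⟨k, p, m, q, hp, hm, hq, rfl⟩ := hg
  exact ⟨j + k, p, m, q, hp, hm, hq, by rw [zpow_add]; simp only [mul_assoc]⟩

theorem form_a (h : s * t * s = t * s * t) {g : G} (hg : BForm s t g) :
    BForm s t ((s * t * s) * g) := by
  obtain ⟨k, p, m, q, hp, hm, hq, rfl⟩ := hg
  have hc : Commute (s * t * s) (((s * t * s) * (s * t * s)) ^ k) :=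
    ((Commute.refl (s * t * s)).mul_right (Commute.refl _)).zpow_right k
  rw [← mul_assoc, hc.eq, mul_assoc]
  apply form_z
  rcases hp with rfl | rfl
  · exact ⟨0, s * t * s, m, q, Or.inr rfl, hm, hq, by simp [mul_assoc]⟩
  · exact ⟨1, 1, m, q, Or.inl rfl, hm, hq, by simp [mul_assoc]⟩

theorem form_b (h : s * t * s = t * s * t) {g : G} (hg : BForm s t g) :
    BForm s t ((s * t) * g) := by
  obtain ⟨k, p, m, q, hp, hm, hq, rfl⟩ := hg
  have hc : Commute (s * t) (((s * t * s) * (s * t * s)) ^ k) :=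
    (((b_zs h).mul_right (b_zt h)).symm).zpow_right k
  rw [← mul_assoc, hc.eq, mul_assoc]
  apply form_z
  rcases hp with rfl | rfl
  · cases hm with
    | one =>
      rcases hq with rfl | rfl | rfl
      · exact ⟨0, 1, 1, _, Or.inl rfl, .one, Or.inr (Or.inl rfl), by simp⟩
      · exact ⟨0, 1, 1, _, Or.inl rfl, .one, Or.inr (Or.inr rfl), by simp⟩
      · exact ⟨1, 1, 1, _, Or.inl rfl, .one, Or.inl rfl, by
          simp only [one_mul, b_bbb h, zpow_one, mul_one]⟩
    | left m' hm' =>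
      exact ⟨0, _, m', q, Or.inr rfl, hm', hq, by simp [mul_assoc]⟩
    | right m' hm' =>
      exact ⟨0, 1, s * m', q, Or.inl rfl, .left _ hm', hq, by simp [mul_assoc]⟩
  · refine ⟨1, 1, t⁻¹ * m, q, Or.inl rfl, .right _ hm, hq, ?_⟩
    have : (s * t) * (s * t * s) = ((s * t * s) * (s * t * s)) * t⁻¹ := by
      rw [eq_mul_inv_iff_mul_eq, ← b_bbb h]
      group
    rw [zpow_one, one_mul, ← mul_assoc, ← mul_assoc, this]
    simp only [mul_assoc]

theorem form_all (h : s * t * s = t * s * t) (g : G)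
    (hg : g ∈ Subgroup.closure ({s, t} : Set G)) : BForm s t g := by
  have hba : (s * t) * (s * t * s) = ((s * t * s) * (s * t * s)) * t⁻¹ := by
    rw [eq_mul_inv_iff_mul_eq, ← b_bbb h]
    group
  have hti : ∀ y : G, BForm s t y → BForm s t (t⁻¹ * y) := by
    intro y hy
    have := form_z (-1) (form_b h (form_a h hy))
    rw [← mul_assoc (s * t), hba, zpow_neg_one] at this
    convert this using 1
    group
  have hsi : ∀ y : G, BForm s t y → BForm s t (s⁻¹ * y) := by
    intro y hy
    have := form_z (-1) (form_a h (form_b h hy))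
    rw [zpow_neg_one] at this
    convert this using 1
    group
  have hs : ∀ y : G, BForm s t y → BForm s t (s * y) := by
    intro y hy
    have := form_b h (hti y hy)
    convert this using 1
    group
  have ht : ∀ y : G, BForm s t y → BForm s t (t * y) := by
    intro y hy
    have := hsi _ (form_b h hy)
    convert this using 1
    group
  induction hg using Subgroup.closure_induction_left with
  | one => exact ⟨0, 1, 1, 1, Or.inl rfl, .one, Or.inl rfl, by simp⟩
  | mul_left x hx y _ ih =>
    rcases hx with rfl | rfl
    · exact hs _ ih
    · exact ht _ ih
  | inv_mul_cancel x hx y _ ih =>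
    rcases hx with rfl | rfl
    · exact hsi _ ih
    · exact hti _ ih

open Complex in
theorem mon_mat (E : G →* Matrix (Fin 2) (Fin 2) ℂ)
    (hs : E s = !![1, -I; 0, 1]) (ht' : E t⁻¹ = !![1, 0; I, 1]) (m : G) (hm : BMon s t m) :
    ∃ x y z w : ℕ, E m = !![(x : ℂ), -I * y; I * z, w] ∧ 1 ≤ x ∧ 1 ≤ w ∧
      (m = 1 ∨ 1 ≤ y + z) := by
  induction hm with
  | one => exact ⟨1, 0, 0, 1, by simp [Matrix.one_fin_two], le_rfl, le_rfl, Or.inl rfl⟩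
  | left m _ ih =>
    obtain ⟨x, y, z, w, e, hx, hw, -⟩ := ih
    refine ⟨x + z, y + w, z, w, ?_, by omega, hw, Or.inr (by omega)⟩
    rw [_root_.map_mul, hs, e, Matrix.mul_fin_two]
    ext i j
    fin_cases i <;> fin_cases j <;> simp
    · linear_combination (-(z : ℂ)) * I_mul_I
    · ring
  | right m _ ih =>
    obtain ⟨x, y, z, w, e, hx, hw, -⟩ := ih
    refine ⟨x, y, x + z, y + w, ?_, hx, by omega, Or.inr (by omega)⟩
    rw [_root_.map_mul, ht', e, Matrix.mul_fin_two]
    ext i j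
    fin_cases i <;> fin_cases j <;> simp
    · ring
    · linear_combination (-(y : ℂ)) * I_mul_I

open Complex in
theorem b_ker (h : s * t * s = t * s * t) (E : G →* Matrix (Fin 2) (Fin 2) ℂ)
    (hs : E s = !![1, -I; 0, 1]) (ht : E t = !![1, 0; -I, 1])
    (d : G →* ℚˣ) (hds : (d s : ℚ) = -4) (hdt : (d t : ℚ) = -4)
    (g : G) (hg : g ∈ Subgroup.closure ({s, t} : Set G)) (hE : E g = 1) (hd : d g = 1) :
    g = 1 := by
  have ht' : E t⁻¹ = !![1, 0; I, 1] := by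
    have h1 : !![1, 0; I, 1] * E t = 1 := by
      rw [ht, Matrix.mul_fin_two, Matrix.one_fin_two]; simp
    have h2 : E t * E t⁻¹ = 1 := by rw [← _root_.map_mul]; simp
    exact (left_inv_eq_right_inv h1 h2).symm
  have hEb : E (s * t) = !![0, -I; -I, 1] := by
    rw [_root_.map_mul, hs, ht, Matrix.mul_fin_two]; simp
  have hEa : E (s * t * s) = !![0, -I; -I, 0] := by
    rw [_root_.map_mul, hEb, hs, Matrix.mul_fin_two]; simp
  have hEz : E ((s * t * s) * (s * t * s)) = -1 := by
    rw [_root_.map_mul, hEa, Matrix.mul_fin_two, Matrix.one_fin_two]; simp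
  have hEzi : E ((s * t * s) * (s * t * s))⁻¹ = -1 := by
    have h1 : -1 * E ((s * t * s) * (s * t * s)) = 1 := by rw [hEz]; simp
    have h2 : E ((s * t * s) * (s * t * s)) * E ((s * t * s) * (s * t * s))⁻¹ = 1 := by
      rw [← _root_.map_mul, mul_inv_cancel, _root_.map_one]
    exact (left_inv_eq_right_inv h1 h2).symm
  have hEbb : E (s * t * (s * t)) = !![-1, -I; -I, 0] := by
    rw [_root_.map_mul, hEb, Matrix.mul_fin_two]; simp
  obtain ⟨k, p, m, q, hp, hm, hq, rfl⟩ := form_all h g hg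
  generalize hzz : (s * t * s) * (s * t * s) = Z at *
  have hk : E (Z ^ k) = 1 ∨ E (Z ^ k) = -1 := by
    clear hE hd hg
    induction k using Int.induction_on with
    | zero => simp
    | succ i ih =>
      have ih := ih
      rw [zpow_add, zpow_one, _root_.map_mul, hEz]
      rcases ih with ih | ih <;> rw [ih] <;> simp
    | pred i ih =>
      rw [zpow_sub, zpow_one, _root_.map_mul, hEzi]
      rcases ih with ih | ih <;> rw [ih] <;> simp
  obtain ⟨x, y, z, w, e, hx, hw, hyz⟩ := mon_mat E hs ht' m hm
  have hx' : (1 : ℝ) ≤ x := by exact_mod_cast hx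
  have hw' : (1 : ℝ) ≤ w := by exact_mod_cast hw
  have hy' : (0 : ℝ) ≤ y := by positivity
  have hz' : (0 : ℝ) ≤ z := by positivity
  have key : E (p * m * q) = 1 ∨ E (p * m * q) = -1 := by
    rw [_root_.map_mul] at hE
    rcases hk with hk | hk <;> rw [hk] at hE
    · left; simpa using hE
    · right; rw [← hE]; simp
  have key2 : p = 1 ∧ q = 1 ∧ y = 0 ∧ z = 0 := by
    rw [_root_.map_mul, _root_.map_mul, e] at key
    have ent : ∀ (A : Matrix (Fin 2) (Fin 2) ℂ), A = 1 ∨ A = -1 →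
        (A 0 0).re = (A 1 1).re ∧ A 0 1 = 0 ∧ A 1 0 = 0 := by
      rintro A (rfl | rfl) <;> simp
    obtain ⟨k1, k2, k3⟩ := ent _ key
    have k2' := congrArg Complex.im k2
    have k3' := congrArg Complex.im k3
    have k2 := congrArg Complex.re k2
    have k3 := congrArg Complex.re k3
    rcases hp with rfl | rfl <;> rcases hq with rfl | rfl | rfl <;>
      simp only [hEa, hEb, hEbb, _root_.map_one, mul_one, one_mul, Matrix.mul_fin_two] at k1 k2 k3 k2' k3' <;>
      simp at k1 k2 k3 k2' k3' 
    · exact ⟨rfl, rfl, by assumption_mod_cast, by assumption_mod_cast⟩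
    all_goals exfalso; linarith
  obtain ⟨rfl, rfl, hy0, hz0⟩ := key2
  have hm1 : m = 1 := by
    rcases hyz with h | h
    · exact h
    · omega
  subst hm1
  simp only [mul_one] at hd ⊢
  have hdz : (d Z : ℚ) = 4096 := by
    rw [← hzz]; simp only [_root_.map_mul, Units.val_mul, hds, hdt]; norm_num
  rw [_root_.map_zpow] at hd
  have hd2 : (4096 : ℚ) ^ k = 1 := by
    rw [← hdz, ← Units.val_zpow_eq_zpow_val, hd]; rfl
  have : k = 0 := by
    rw [zpow_eq_one_iff_right₀ (by norm_num) (by norm_num)] at hd2; exact hd2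
  simp [this]

end

/-- The 3-strand Burau representation is faithful. -/
theorem burau_three_strand_faithful :
    (∃ π : B3 →* GL (Fin 2) (LaurentPolynomial ℤ),
      ∀ i : Fin 2, (π (PresentedGroup.of i) : Matrix (Fin 2) (Fin 2) (LaurentPolynomial ℤ)) = BurauA i) ∧
    (∀ π : B3 →* GL (Fin 2) (LaurentPolynomial ℤ),
      (∀ i : Fin 2, (π (PresentedGroup.of i) : Matrix (Fin 2) (Fin 2) (LaurentPolynomial ℤ)) = BurauA i) →
      Function.Injective π) := by
  constructor
  · have hdet : ∀ i, IsUnit (BurauA i).det := by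
      have hu : IsUnit (-(T 1 : LaurentPolynomial ℤ) ^ 2) := ((isUnit_T 1).pow 2).neg
      intro i
      fin_cases i
      · simpa [BurauA, Matrix.det_fin_two] using hu
      · simpa [BurauA, Matrix.det_fin_two] using hu
    let f : Fin 2 → GL (Fin 2) (LaurentPolynomial ℤ) :=
      fun i => Matrix.GeneralLinearGroup.mk'' (BurauA i) (hdet i)
    have hf : ∀ i, (f i : Matrix (Fin 2) (Fin 2) (LaurentPolynomial ℤ)) = BurauA i := fun i => rfl
    have hr : ∀ r ∈ braidRels3, FreeGroup.lift f r = 1 := by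
      intro r hr
      rw [braidRels3, Set.mem_singleton_iff] at hr
      subst hr
      rw [_root_.map_mul, _root_.map_inv, mul_inv_eq_one]
      simp only [_root_.map_mul, FreeGroup.lift_apply_of]
      apply Units.ext
      simp only [Units.val_mul, hf]
      simp only [BurauA, Matrix.mul_fin_two]
      generalize (T 1 : LaurentPolynomial ℤ) = v
      ext1 i j
      fin_cases i <;> fin_cases j <;> simp <;> ring_nf <;> simp
    refine ⟨(PresentedGroup.toGroup hr : PresentedGroup braidRels3 →* _), fun i => ?_⟩
    rw [← hf i]
    exact congrArg Units.val (PresentedGroup.toGroup.of hr)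
  · intro π hπ
    rw [injective_iff_map_eq_one]
    intro g hg
    let s : B3 := (PresentedGroup.of 0 : PresentedGroup braidRels3)
    let t : B3 := (PresentedGroup.of 1 : PresentedGroup braidRels3)
    have h0 : (π s : Matrix (Fin 2) (Fin 2) (LaurentPolynomial ℤ)) = BurauA 0 := hπ 0
    have h1 : (π t : Matrix (Fin 2) (Fin 2) (LaurentPolynomial ℤ)) = BurauA 1 := hπ 1
    have hrel : s * t * s = t * s * t := by
      have := PresentedGroup.one_of_mem (rels := braidRels3) (x := of 0 * of 1 * of 0 * (of 1 * of 0 * of 1)⁻¹) rfl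
      rw [_root_.map_mul, _root_.map_inv, mul_inv_eq_one] at this
      exact this
    have hcl : g ∈ Subgroup.closure ({s, t} : Set B3) := by
      have h2 := PresentedGroup.closure_range_of braidRels3
      have h3 : Set.range (PresentedGroup.of : Fin 2 → PresentedGroup braidRels3) = {s, t} := by
        ext x
        simp only [Set.mem_range, Fin.exists_fin_two, Set.mem_insert_iff, Set.mem_singleton_iff]
        exact or_congr eq_comm eq_comm
      rw [h3] at h2
      exact (Subgroup.eq_top_iff' _).1 h2 g
    let uI : ℂˣ := Units.mk0 Complex.I Complex.I_ne_zero
    let u2 : ℚˣ := Units.mk0 2 two_ne_zero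
    let e1 : LaurentPolynomial ℤ →+* ℂ := LaurentPolynomial.eval₂ (Int.castRingHom ℂ) uI
    let e2 : LaurentPolynomial ℤ →+* ℚ := LaurentPolynomial.eval₂ (Int.castRingHom ℚ) u2
    have he1 : e1 (T 1) = Complex.I := by
      simp only [e1, LaurentPolynomial.eval₂_T, zpow_one]; rfl
    have he2 : e2 (T 1) = 2 := by
      simp only [e2, LaurentPolynomial.eval₂_T, zpow_one]; rfl
    have hT : (T 2 : LaurentPolynomial ℤ) = T 1 * T 1 := by rw [← T_add]; norm_num
    have he3 : e1 (T 2) = -1 := by rw [hT, _root_.map_mul, he1, Complex.I_mul_I]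
    have he4 : e2 (T 2) = 4 := by rw [hT, _root_.map_mul, he2]; norm_num
    let E : B3 →* Matrix (Fin 2) (Fin 2) ℂ :=
      (RingHom.toMonoidHom (e1.mapMatrix)).comp ((Units.coeHom _).comp π)
    let d : B3 →* ℚˣ := (Units.map (RingHom.toMonoidHom e2)).comp (Matrix.GeneralLinearGroup.det.comp π)
    have hE : ∀ x, E x = (π x : Matrix (Fin 2) (Fin 2) (LaurentPolynomial ℤ)).map e1 := fun _ => rfl
    have hd : ∀ x, (d x : ℚ) = e2 (π x : Matrix (Fin 2) (Fin 2) (LaurentPolynomial ℤ)).det :=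
      fun _ => rfl
    refine b_ker hrel E ?_ ?_ d ?_ ?_ g hcl ?_ ?_
    · rw [hE, h0]; ext i j; fin_cases i <;> fin_cases j <;> simp [BurauA, he1, he3]
    · rw [hE, h1]; ext i j; fin_cases i <;> fin_cases j <;> simp [BurauA, he1, he3]
    · rw [hd, h0]; simp [BurauA, Matrix.det_fin_two, he4]
    · rw [hd, h1]; simp [BurauA, Matrix.det_fin_two, he4]
    · rw [hE, hg]; simp
    · apply Units.ext; rw [hd, hg]; simp
end
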